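/- A recurrent infinite word has two return words for each of its factors if and only if it is Sturmian. -/

import Mathlib

variable {α : Type*}

/-- The factor of the infinite word `w` of length `n` starting at position `i`. -/
def factorAt (w : ℕ → α) (i n : ℕ) : List α :=
  (List.range n).map fun k => w (i + k)

/-- `u` is a factor of the infinite word `w`. -/
def IsFactor (w : ℕ → α) (u : List α) : Prop :=
  ∃ i, factorAt w i u.length = u

/-- `w` is recurrent: each of its factors occurs infinitely many times. -/
def Recurrent (w : ℕ → α) : Prop :=
  ∀ u : List α, IsFactor w u → ∀ N : ℕ, ∃ i, N ≤ i ∧ factorAt w i u.length = u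

/-- `w` is periodic: there is `T > 0` with `w (n + T) = w n` for all `n`. -/
def Periodic (w : ℕ → α) : Prop :=
  ∃ T : ℕ, 0 < T ∧ ∀ n, w (n + T) = w n

def Aperiodic (w : ℕ → α) : Prop := ¬ Periodic w

def UltimatelyPeriodic (w : ℕ → α) : Prop :=
  ∃ N T : ℕ, 0 < T ∧ ∀ n, N ≤ n → w (n + T) = w n

/-- `w` is Sturmian: aperiodic with subword complexity `n + 1`. -/
def Sturmian (w : ℕ → α) : Prop :=
  Aperiodic w ∧ ∀ n : ℕ, {u : List α | u.length = n ∧ IsFactor w u}.ncard = n + 1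

/-- Positions where `u` occurs in `w`. -/
def Occurrences (w : ℕ → α) (u : List α) : Set ℕ :=
  {i | factorAt w i u.length = u}

/-- The return words of `u` in `w`: words from one occurrence of `u` to the next. -/
def ReturnWords (w : ℕ → α) (u : List α) : Set (List α) :=
  {r | ∃ i j : ℕ, i ∈ Occurrences w u ∧ j ∈ Occurrences w u ∧ i < j ∧
    (∀ k, i < k → k < j → k ∉ Occurrences w u) ∧ r = factorAt w i (j - i)}

/-- Positions where a word abelian-equivalent to `u` occurs in `w`. -/
def AbelianOccurrences (w : ℕ → α) (u : List α) : Set ℕ :=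
  {i | List.Perm (factorAt w i u.length) u}

/-- The abelian return words of `u` in `w`. -/
def AbelianReturnWords (w : ℕ → α) (u : List α) : Set (List α) :=
  {r | ∃ i j : ℕ, i ∈ AbelianOccurrences w u ∧ j ∈ AbelianOccurrences w u ∧ i < j ∧
    (∀ k, i < k → k < j → k ∉ AbelianOccurrences w u) ∧ r = factorAt w i (j - i)}

/-- The abelian equivalence classes (as multisets) of the abelian return words of `u` in `w`. -/
def abelianReturnClasses (w : ℕ → α) (u : List α) : Set (Multiset α) :=
  (fun r : List α => (r : Multiset α)) '' AbelianReturnWords w u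

def RightSpecial (w : ℕ → α) (u : List α) : Prop :=
  ∃ a b : α, a ≠ b ∧ IsFactor w (u ++ [a]) ∧ IsFactor w (u ++ [b])

def LeftSpecial (w : ℕ → α) (u : List α) : Prop :=
  ∃ a b : α, a ≠ b ∧ IsFactor w (a :: u) ∧ IsFactor w (b :: u)

def Bispecial (w : ℕ → α) (u : List α) : Prop :=
  RightSpecial w u ∧ LeftSpecial w u

/-- A factor is singular if it is the only factor of `w` in its abelian class. -/
def Singular (w : ℕ → α) (u : List α) : Prop :=
  ∀ v : List α, IsFactor w v → List.Perm v u → v = u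

/-- `w` is an infinite concatenation of words from `S`. -/
def InfConcat (S : Set (List α)) (w : ℕ → α) : Prop :=
  ∃ f : ℕ → List α, (∀ n, f n ∈ S) ∧
    ∀ n, factorAt w (((List.range n).map fun k => (f k).length).sum) (f n).length = f n

/-- A finite binary word is balanced if any two factors of equal length have numbers
of occurrences of `true` differing by at most one. -/
def BalancedList (w : List Bool) : Prop :=
  ∀ u v : List Bool, u <:+: w → v <:+: w → u.length = v.length →
    |(u.count true : ℤ) - (v.count true : ℤ)| ≤ 1


/-- `i` and `j` are consecutive occurrences of `u` in `w`. -/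
def ConsecutiveOcc (w : ℕ → α) (u : List α) (i j : ℕ) : Prop :=
  i ∈ Occurrences w u ∧ j ∈ Occurrences w u ∧ i < j ∧
    ∀ k, i < k → k < j → k ∉ Occurrences w u

/-- The factors of `w` of length `n`. -/
def factorsOfLength (w : ℕ → α) (n : ℕ) : Set (List α) :=
  {u | u.length = n ∧ IsFactor w u}

section Occurrences

variable {w : ℕ → α} {u : List α} {i j : ℕ}

@[simp] theorem length_factorAt (w : ℕ → α) (i n : ℕ) : (factorAt w i n).length = n := by
  simp [factorAt]

theorem factorAt_eq_iff {n : ℕ} :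
    factorAt w i n = factorAt w j n ↔ ∀ k < n, w (i + k) = w (j + k) := by
  simp [factorAt]

theorem factorAt_succ (w : ℕ → α) (i n : ℕ) :
    factorAt w i (n + 1) = factorAt w i n ++ [w (i + n)] := by
  simp [factorAt, List.range_succ]

theorem factorAt_succ' (w : ℕ → α) (i n : ℕ) :
    factorAt w i (n + 1) = w i :: factorAt w (i + 1) n := by
  simp [factorAt, List.range_succ_eq_map, Nat.add_comm, Nat.add_left_comm]

theorem mem_occurrences_cons {c : α} :
    i ∈ Occurrences w (c :: u) ↔ w i = c ∧ i + 1 ∈ Occurrences w u := by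
  simp [Occurrences, factorAt_succ']

theorem mem_occurrences_concat {a : α} :
    i ∈ Occurrences w (u ++ [a]) ↔ i ∈ Occurrences w u ∧ w (i + u.length) = a := by
  simp [Occurrences, factorAt_succ]

theorem mem_occurrences_factorAt {n : ℕ} :
    j ∈ Occurrences w (factorAt w i n) ↔ ∀ k < n, w (j + k) = w (i + k) := by
  simp [Occurrences, factorAt_eq_iff]

theorem eq_of_mem_occurrences (hi : i ∈ Occurrences w u) (hj : j ∈ Occurrences w u) :
    ∀ k < u.length, w (i + k) = w (j + k) :=
  factorAt_eq_iff.1 (Eq.trans hi (Eq.symm hj))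

theorem mem_occurrences_of_eq (hi : i ∈ Occurrences w u)
    (h : ∀ k < u.length, w (i + k) = w (j + k)) : j ∈ Occurrences w u :=
  Eq.trans (factorAt_eq_iff.2 fun k hk => (h k hk).symm) hi

theorem isFactor_iff : IsFactor w u ↔ ∃ i, i ∈ Occurrences w u := Iff.rfl

theorem isFactor_factorAt (w : ℕ → α) (i n : ℕ) : IsFactor w (factorAt w i n) :=
  ⟨i, by simp⟩

theorem rightSpecial_iff : RightSpecial w u ↔ ∃ i j, i ∈ Occurrences w u ∧
    j ∈ Occurrences w u ∧ w (i + u.length) ≠ w (j + u.length) := by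
  simp only [RightSpecial, isFactor_iff, mem_occurrences_concat]
  constructor
  · rintro ⟨a, b, hab, ⟨i, hi, rfl⟩, ⟨j, hj, rfl⟩⟩
    exact ⟨i, j, hi, hj, hab⟩
  · rintro ⟨i, j, hi, hj, h⟩
    exact ⟨_, _, h, ⟨i, hi, rfl⟩, ⟨j, hj, rfl⟩⟩

theorem RightSpecial.isFactor (h : RightSpecial w u) : IsFactor w u := by
  obtain ⟨i, -, hi, -⟩ := rightSpecial_iff.1 h
  exact ⟨i, hi⟩

theorem RightSpecial.of_cons {c : α} (h : RightSpecial w (c :: u)) : RightSpecial w u := by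
  obtain ⟨i, j, hi, hj, hij⟩ := rightSpecial_iff.1 h
  rw [mem_occurrences_cons] at hi hj
  refine rightSpecial_iff.2 ⟨i + 1, j + 1, hi.2, hj.2, ?_⟩
  simpa [Nat.add_comm, Nat.add_left_comm] using hij

theorem Recurrent.exists_consecutiveOcc (hrec : Recurrent w) (hi : i ∈ Occurrences w u) :
    ∃ j, ConsecutiveOcc w u i j := by
  classical
  have h : ∃ j, i < j ∧ j ∈ Occurrences w u := by
    obtain ⟨j, hj, hju⟩ := hrec u ⟨i, hi⟩ (i + 1)
    exact ⟨j, hj, hju⟩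
  refine ⟨Nat.find h, hi, (Nat.find_spec h).2, (Nat.find_spec h).1, fun k hik hk hku => ?_⟩
  exact Nat.find_min h hk ⟨hik, hku⟩

theorem exists_consecutiveOcc_left (hi : i ∈ Occurrences w u) (hj : j ∈ Occurrences w u)
    (hij : i < j) : ∃ k, i ≤ k ∧ ConsecutiveOcc w u k j := by
  classical
  let P : ℕ → Prop := fun k => k < j ∧ k ∈ Occurrences w u
  have hP : P (Nat.findGreatest P j) := Nat.findGreatest_spec hij.le ⟨hij, hi⟩
  refine ⟨Nat.findGreatest P j, Nat.le_findGreatest hij.le ⟨hij, hi⟩, hP.2, hj, hP.1, ?_⟩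
  exact fun k hk hkj hku => Nat.findGreatest_is_greatest hk hkj.le ⟨hkj, hku⟩

theorem mem_returnWords {r : List α} :
    r ∈ ReturnWords w u ↔ ∃ i j, ConsecutiveOcc w u i j ∧ r = factorAt w i (j - i) := by
  simp [ReturnWords, ConsecutiveOcc, and_assoc]

theorem returnWords_eq_of_occurrences_eq {v : List α} (h : Occurrences w u = Occurrences w v) :
    ReturnWords w u = ReturnWords w v := by
  simp [ReturnWords, h]

/-- The distance to the next occurrence is determined by the letters read on the way. -/
theorem ConsecutiveOcc.sub_eq {i' j' : ℕ} (h : ConsecutiveOcc w u i j)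
    (h' : ConsecutiveOcc w u i' j')
    (heq : ∀ m < u.length + min (j - i) (j' - i'), w (i + m) = w (i' + m)) :
    j - i = j' - i' := by
  obtain ⟨-, hj, hij, hn⟩ := h
  obtain ⟨-, hj', hij', hn'⟩ := h'
  rcases lt_trichotomy (j - i) (j' - i') with hlt | heq' | hlt
  · refine absurd ?_ (hn' (i' + (j - i)) (by omega) (by omega))
    refine mem_occurrences_of_eq hj fun k hk => ?_
    have := heq (j - i + k) (by omega)
    rwa [show i + (j - i + k) = j + k by omega, ← Nat.add_assoc] at this
  · exact heq'
  · refine absurd ?_ (hn (i + (j' - i')) (by omega) (by omega))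
    refine mem_occurrences_of_eq hj' fun k hk => ?_
    have := heq (j' - i' + k) (by omega)
    rw [show i' + (j' - i' + k) = j' + k by omega, ← Nat.add_assoc] at this
    exact this.symm

/-- Equal return words extend to equal complete return words. -/
theorem ConsecutiveOcc.eq_of_factorAt_eq {i' j' : ℕ} (h : ConsecutiveOcc w u i j)
    (h' : ConsecutiveOcc w u i' j') (heq : factorAt w i (j - i) = factorAt w i' (j' - i')) :
    j - i = j' - i' ∧ ∀ m < u.length + (j - i), w (i + m) = w (i' + m) := by
  have hlen : j - i = j' - i' := by simpa using congrArg List.length heq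
  refine ⟨hlen, fun m hm => ?_⟩
  have hij := h.2.2.1
  have hij' := h'.2.2.1
  rw [← hlen, factorAt_eq_iff] at heq
  rcases lt_or_ge m (j - i) with hlt | hge
  · exact heq m hlt
  · have := eq_of_mem_occurrences h.2.1 h'.2.1 (m - (j - i)) (by omega)
    rwa [show j + (m - (j - i)) = i + m by omega,
      show j' + (m - (j - i)) = i' + m by omega] at this

/-- A factor which determines all letters following it has at most one return word. -/
theorem encard_returnWords_le_one
    (h : ∀ i ∈ Occurrences w u, ∀ j ∈ Occurrences w u, ∀ m, w (i + m) = w (j + m)) :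
    (ReturnWords w u).encard ≤ 1 := by
  rw [Set.encard_le_one_iff]
  intro r s hr hs
  obtain ⟨i, j, hij, rfl⟩ := mem_returnWords.1 hr
  obtain ⟨i', j', hij', rfl⟩ := mem_returnWords.1 hs
  have := h i hij.1 i' hij'.1
  rw [hij.sub_eq hij' fun m _ => this m, factorAt_eq_iff]
  exact fun k _ => this k

end Occurrences

section TwoReturns

variable {w : ℕ → α}

theorem exists_range_eq_pair (h : (ReturnWords w []).encard = 2) :
    ∃ a b, a ≠ b ∧ Set.range w = {a, b} := by
  have hR : ReturnWords w [] = (fun a => [a]) '' Set.range w := by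
    ext r
    simp only [mem_returnWords, ConsecutiveOcc, Set.mem_image, Set.mem_range,
      exists_exists_eq_and]
    have hocc : ∀ k, k ∈ Occurrences w [] := fun k => by simp [Occurrences, factorAt]
    simp only [hocc, true_and, not_true_eq_false, imp_false]
    constructor
    · rintro ⟨i, j, ⟨hij, hk⟩, rfl⟩
      have : j = i + 1 := by
        by_contra hne
        exact hk (i + 1) (by omega) (by omega)
      subst this
      exact ⟨i, by simp [factorAt]⟩
    · rintro ⟨i, rfl⟩
      exact ⟨i, i + 1, ⟨by omega, fun k _ => by omega⟩, by simp [factorAt]⟩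
  rw [hR, Function.Injective.encard_image fun a b hab => by simpa using hab,
    Set.encard_eq_two] at h
  exact h

/-- If a right special factor has two return words, the complete return word is determined
by the letter following the factor. -/
theorem RightSpecial.complete_return_eq {u : List α} (hrec : Recurrent w)
    (hu : RightSpecial w u) (h2 : (ReturnWords w u).encard = 2) {i j i' j' : ℕ}
    (h : ConsecutiveOcc w u i j) (h' : ConsecutiveOcc w u i' j')
    (hl : w (i + u.length) = w (i' + u.length)) :
    j - i = j' - i' ∧ ∀ m < u.length + (j - i), w (i + m) = w (i' + m) := by
  refine h.eq_of_factorAt_eq h' ?_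
  obtain ⟨k, hk, hkl⟩ : ∃ k ∈ Occurrences w u, w (i + u.length) ≠ w (k + u.length) := by
    obtain ⟨k, l, hk, hl, hkl⟩ := rightSpecial_iff.1 hu
    by_cases hc : w (i + u.length) = w (k + u.length)
    · exact ⟨l, hl, hc ▸ hkl⟩
    · exact ⟨k, hk, hc⟩
  obtain ⟨l, h''⟩ := hrec.exists_consecutiveOcc hk
  have hne : factorAt w i (j - i) ≠ factorAt w k (l - k) := fun he =>
    hkl ((h.eq_of_factorAt_eq h'' he).2 _ (by have := h.2.2.1; omega))
  have hne' : factorAt w i' (j' - i') ≠ factorAt w k (l - k) := fun he =>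
    hkl (hl.trans ((h'.eq_of_factorAt_eq h'' he).2 _ (by have := h'.2.2.1; omega)))
  obtain ⟨r, s, -, hrs⟩ := Set.encard_eq_two.1 h2
  have m1 : factorAt w i (j - i) ∈ ReturnWords w u := mem_returnWords.2 ⟨i, j, h, rfl⟩
  have m2 : factorAt w i' (j' - i') ∈ ReturnWords w u := mem_returnWords.2 ⟨i', j', h', rfl⟩
  have m3 : factorAt w k (l - k) ∈ ReturnWords w u := mem_returnWords.2 ⟨k, l, h'', rfl⟩
  rw [hrs] at m1 m2 m3
  simp only [Set.mem_insert_iff, Set.mem_singleton_iff] at m1 m2 m3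
  grind

theorem exists_rightSpecial (h2 : ∀ u, IsFactor w u → (ReturnWords w u).encard = 2) (n : ℕ) :
    ∃ u, u.length = n ∧ RightSpecial w u := by
  by_contra! hno
  have hstep : ∀ i j, (∀ k < n, w (i + k) = w (j + k)) → w (i + n) = w (j + n) := by
    intro i j hij
    by_contra hne
    refine hno (factorAt w i n) (by simp) (rightSpecial_iff.2 ⟨i, j, ?_, ?_, by simpa⟩)
    · simp [mem_occurrences_factorAt]
    · exact mem_occurrences_factorAt.2 fun k hk => (hij k hk).symm
  have h := h2 _ (isFactor_factorAt w 0 n)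
  have hle : (ReturnWords w (factorAt w 0 n)).encard ≤ 1 := by
    refine encard_returnWords_le_one fun i hi j hj m => ?_
    have hij := eq_of_mem_occurrences hi hj
    rw [length_factorAt] at hij
    induction m using Nat.strong_induction_on with
    | _ m ih =>
      rcases lt_or_ge m n with hlt | hge
      · exact hij m hlt
      · have := hstep (i + (m - n)) (j + (m - n)) fun k hk => by
          simpa [Nat.add_assoc] using ih (m - n + k) (by omega)
        rwa [Nat.add_assoc, Nat.add_assoc, Nat.sub_add_cancel hge] at this
  rw [h] at hle
  exact absurd hle (by norm_num)

/-- From an occurrence of `c x b`, the word is determined up to some later occurrence of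
`d x a`, when the return to `x` after the letter `a` is preceded by `c`. -/
theorem exists_common_occurrence (hrec : Recurrent w) {x : List α} {a b c d : α}
    (hab : a ≠ b) (hl : ∀ i, w i = a ∨ w i = b) (hcd : ∀ i, w i = c ∨ w i = d) (hne : c ≠ d)
    (hb : ∀ i j, ConsecutiveOcc w x i j → w (i + x.length) = b → w (j - 1) = d)
    (hcx : RightSpecial w (c :: x)) (h2 : (ReturnWords w (c :: x)).encard = 2) {p q : ℕ}
    (hp : p ∈ Occurrences w (c :: x ++ [b])) (hq : q ∈ Occurrences w (c :: x ++ [b])) :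
    ∃ L, 0 < L ∧ (∀ m < L, w (p + m) = w (q + m)) ∧
      p + L ∈ Occurrences w (d :: x ++ [a]) ∧ q + L ∈ Occurrences w (d :: x ++ [a]) := by
  rw [mem_occurrences_concat] at hp hq
  obtain ⟨p', hpp⟩ := hrec.exists_consecutiveOcc hp.1
  obtain ⟨q', hqq⟩ := hrec.exists_consecutiveOcc hq.1
  obtain ⟨-, heq⟩ := hcx.complete_return_eq hrec h2 hpp hqq (hp.2.trans hq.2.symm)
  have hpx := mem_occurrences_cons.1 hp.1
  have hpx' := mem_occurrences_cons.1 hpp.2.1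
  have hlt := hpp.2.2.1
  obtain ⟨s, hps, hs⟩ := exists_consecutiveOcc_left hpx.2 hpx'.2 (by omega)
  have hsa : w (s + x.length) = a := (hl _).resolve_right fun h =>
    hne (hpx'.1.symm.trans (by simpa using hb s (p' + 1) hs h))
  have hps' : p + 1 ≠ s := by
    rintro rfl
    refine hab (hsa.symm.trans ?_)
    simpa [Nat.add_comm, Nat.add_left_comm] using hp.2
  have hslt := hs.2.2.1
  obtain ⟨t, rfl⟩ : ∃ t, s = t + 1 := ⟨s - 1, by omega⟩
  have htd : w t = d := (hcd t).resolve_left fun h =>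
    hpp.2.2.2 t (by omega) (by omega) (mem_occurrences_cons.2 ⟨h, hs.1⟩)
  have ht : t ∈ Occurrences w (d :: x ++ [a]) :=
    mem_occurrences_concat.2 ⟨mem_occurrences_cons.2 ⟨htd, hs.1⟩, by
      simpa [Nat.add_comm, Nat.add_left_comm] using hsa⟩
  have htp : p + (t - p) = t := by omega
  rw [List.length_cons] at heq
  refine ⟨t - p, by omega, fun m hm => heq m (by omega), by rwa [htp], ?_⟩
  refine mem_occurrences_of_eq ht fun k hk => ?_
  have := heq (t - p + k) (by simp at hk; omega)
  rwa [← Nat.add_assoc, htp, ← Nat.add_assoc] at this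

theorem not_rightSpecial_cons_cons (hrec : Recurrent w)
    (h2 : ∀ u, IsFactor w u → (ReturnWords w u).encard = 2) {x : List α} {c d : α}
    (hne : c ≠ d) (hc : RightSpecial w (c :: x)) (hd : RightSpecial w (d :: x)) : False := by
  obtain ⟨e, f, hef, hrange⟩ := exists_range_eq_pair (h2 [] ⟨0, rfl⟩)
  have hl : ∀ i, w i = e ∨ w i = f := fun i => by
    have : w i ∈ Set.range w := ⟨i, rfl⟩
    simpa [hrange] using this
  have hx : RightSpecial w x := hc.of_cons
  have hret : ∀ i j i' j', ConsecutiveOcc w x i j → ConsecutiveOcc w x i' j' →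
      w (i + x.length) = w (i' + x.length) → w (j - 1) = w (j' - 1) := by
    intro i j i' j' h h' hlet
    obtain ⟨hg, heq⟩ := hx.complete_return_eq hrec (h2 x hx.isFactor) h h' hlet
    have hij := h.2.2.1
    have hij' := h'.2.2.1
    have := heq (j - i - 1) (by omega)
    rwa [show i + (j - i - 1) = j - 1 by omega, show i' + (j - i - 1) = j' - 1 by omega] at this
  obtain ⟨i₀, hi₀⟩ := hx.isFactor
  have hprec : ∀ c', RightSpecial w (c' :: x) →
      ∃ i j, ConsecutiveOcc w x i j ∧ w (j - 1) = c' := by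
    intro c' hc'
    obtain ⟨p, hp, hpo⟩ := hrec _ hc'.isFactor i₀
    have hpo' := mem_occurrences_cons.1 hpo
    obtain ⟨i, -, hi⟩ := exists_consecutiveOcc_left hi₀ hpo'.2 (by omega)
    exact ⟨i, p + 1, hi, by simpa using hpo'.1⟩
  obtain ⟨i, j, hij, rfl⟩ := hprec c hc
  obtain ⟨i', j', hij', rfl⟩ := hprec d hd
  have hab : w (i + x.length) ≠ w (i' + x.length) := fun h => hne (hret _ _ _ _ hij hij' h)
  set a := w (i + x.length) with ha
  set b := w (i' + x.length) with hb
  set c := w (j - 1) with hc_def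
  set d := w (j' - 1) with hd_def
  have hlab : ∀ k, w k = a ∨ w k = b := fun k => by
    have h1 := hl k; have h3 := hl (i + x.length); have h4 := hl (i' + x.length)
    grind
  have hlcd : ∀ k, w k = c ∨ w k = d := fun k => by
    have h1 := hl k; have h3 := hl (j - 1); have h4 := hl (j' - 1)
    grind
  have hcb := fun p q => exists_common_occurrence hrec hab hlab hlcd hne
    (fun k l h hk => hret _ _ _ _ h hij' hk) hc (h2 _ hc.isFactor) (p := p) (q := q)
  have hda := fun p q => exists_common_occurrence hrec hab.symm (fun k => (hlab k).symm)
    (fun k => (hlcd k).symm) hne.symm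
    (fun k l h hk => hret _ _ _ _ h hij hk) hd (h2 _ hd.isFactor) (p := p) (q := q)
  have hdet : ∀ m,
      (∀ p ∈ Occurrences w (c :: x ++ [b]), ∀ q ∈ Occurrences w (c :: x ++ [b]),
        w (p + m) = w (q + m)) ∧
      (∀ p ∈ Occurrences w (d :: x ++ [a]), ∀ q ∈ Occurrences w (d :: x ++ [a]),
        w (p + m) = w (q + m)) := by
    intro m
    induction m using Nat.strong_induction_on with
    | _ m ih =>
      constructor
      · intro p hp q hq
        obtain ⟨L, hL, heq, hpL, hqL⟩ := hcb p q hp hq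
        rcases lt_or_ge m L with hlt | hge
        · exact heq m hlt
        · have := (ih (m - L) (by omega)).2 _ hpL _ hqL
          rwa [Nat.add_assoc, Nat.add_assoc, Nat.add_sub_cancel' hge] at this
      · intro p hp q hq
        obtain ⟨L, hL, heq, hpL, hqL⟩ := hda p q hp hq
        rcases lt_or_ge m L with hlt | hge
        · exact heq m hlt
        · have := (ih (m - L) (by omega)).1 _ hpL _ hqL
          rwa [Nat.add_assoc, Nat.add_assoc, Nat.add_sub_cancel' hge] at this
  have hfac : IsFactor w (c :: x ++ [b]) := by
    obtain ⟨p, q, hp, hq, hpq⟩ := rightSpecial_iff.1 hc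
    rcases hlab (p + (c :: x).length) with h | h
    · exact ⟨q, mem_occurrences_concat.2 ⟨hq, (hlab _).resolve_left fun h' =>
        hpq (h.trans h'.symm)⟩⟩
    · exact ⟨p, mem_occurrences_concat.2 ⟨hp, h⟩⟩
  have hle := encard_returnWords_le_one fun p hp q hq m => (hdet m).1 p hp q hq
  rw [h2 _ hfac] at hle
  exact absurd hle (by norm_num)

theorem RightSpecial.unique (hrec : Recurrent w)
    (h2 : ∀ u, IsFactor w u → (ReturnWords w u).encard = 2) {u v : List α}
    (hu : RightSpecial w u) (hv : RightSpecial w v) (hlen : u.length = v.length) : u = v := by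
  induction u generalizing v with
  | nil => exact (List.eq_nil_of_length_eq_zero hlen.symm).symm
  | cons c x ih =>
    cases v with
    | nil => simp at hlen
    | cons d y =>
      obtain rfl := ih hu.of_cons hv.of_cons (by simpa using hlen)
      by_contra hne
      exact not_rightSpecial_cons_cons hrec h2 (fun h => hne (by rw [h])) hu hv

theorem aperiodic_of_two_returns
    (h2 : ∀ u, IsFactor w u → (ReturnWords w u).encard = 2) : Aperiodic w := by
  rintro ⟨T, hT, hper⟩
  have hdet : ∀ i ∈ Occurrences w (factorAt w 0 T), ∀ m, w (i + m) = w m := by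
    intro i hi m
    rw [mem_occurrences_factorAt] at hi
    induction m using Nat.strong_induction_on with
    | _ m ih =>
      rcases lt_or_ge m T with hlt | hge
      · simpa using hi m hlt
      · have := ih (m - T) (by omega)
        rwa [← hper, ← hper (m - T), Nat.add_assoc, Nat.sub_add_cancel hge] at this
  have hle := encard_returnWords_le_one fun i hi j hj m =>
    (hdet i hi m).trans (hdet j hj m).symm
  rw [h2 _ (isFactor_factorAt w 0 T)] at hle
  exact absurd hle (by norm_num)

end TwoReturns

section Complexity

variable {w : ℕ → α}

theorem finite_factorsOfLength [Finite α] (w : ℕ → α) (n : ℕ) : (factorsOfLength w n).Finite :=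
  (List.finite_length_eq α n).subset fun _ hu => hu.1

theorem factorsOfLength_zero (w : ℕ → α) : factorsOfLength w 0 = {[]} := by
  ext u
  simp only [factorsOfLength, Set.mem_ofPred_eq, List.length_eq_zero_iff, Set.mem_singleton_iff]
  exact ⟨fun h => h.1, fun h => ⟨h, h ▸ ⟨0, rfl⟩⟩⟩

theorem concat_mem_factorsOfLength {n : ℕ} {u : List α} {i : ℕ} (hu : u.length = n)
    (hi : i ∈ Occurrences w u) : u ++ [w (i + n)] ∈ factorsOfLength w (n + 1) :=
  ⟨by simp [hu], i, mem_occurrences_concat.2 ⟨hi, by rw [hu]⟩⟩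

/-- The factors of length `n` extended by a letter other than the one chosen by `e`. -/
def extraFactors (w : ℕ → α) (e : List α → α) (n : ℕ) : Set (List α) :=
  {v ∈ factorsOfLength w (n + 1) | ∀ u, v ≠ u ++ [e u]}

theorem concat_mem_extraFactors {e : List α → α} {n : ℕ} {u : List α} {a : α} :
    u ++ [a] ∈ extraFactors w e n ↔ u ++ [a] ∈ factorsOfLength w (n + 1) ∧ a ≠ e u := by
  refine and_congr_right fun _ => ⟨fun h ha => h u (by rw [ha]), fun h v hv => h ?_⟩
  obtain ⟨rfl, hv⟩ := List.append_inj' hv rfl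
  simpa using hv

theorem RightSpecial.exists_mem_extraFactors {n : ℕ} {u : List α} (hu : RightSpecial w u)
    (hn : u.length = n) (e : List α → α) : ∃ a, u ++ [a] ∈ extraFactors w e n := by
  obtain ⟨i, j, hi, hj, hij⟩ := rightSpecial_iff.1 hu
  rw [hn] at hij
  by_cases h : w (i + n) = e u
  · exact ⟨_, concat_mem_extraFactors.2
      ⟨concat_mem_factorsOfLength hn hj, fun h' => hij (h.trans h'.symm)⟩⟩
  · exact ⟨_, concat_mem_extraFactors.2 ⟨concat_mem_factorsOfLength hn hi, h⟩⟩

/-- There is a choice of a letter following each factor, and the complexity increases by the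
number of the remaining one letter extensions. -/
theorem exists_ncard_factorsOfLength_succ [Finite α] (w : ℕ → α) : ∃ e : List α → α,
    (∀ u, IsFactor w u → IsFactor w (u ++ [e u])) ∧
    ∀ n, (factorsOfLength w (n + 1)).ncard =
      (factorsOfLength w n).ncard + (extraFactors w e n).ncard := by
  have hex : ∀ u : List α, ∃ a, IsFactor w u → IsFactor w (u ++ [a]) := by
    intro u
    by_cases hu : IsFactor w u
    · obtain ⟨i, hi⟩ := hu
      exact ⟨w (i + u.length), fun _ => ⟨i, mem_occurrences_concat.2 ⟨hi, rfl⟩⟩⟩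
    · exact ⟨w 0, fun h => absurd h hu⟩
  choose e he using hex
  refine ⟨e, he, fun n => ?_⟩
  have hinj : Function.Injective fun u => u ++ [e u] := fun u v h =>
    (List.append_inj' h rfl).1
  have hsub : (fun u => u ++ [e u]) '' factorsOfLength w n ⊆ factorsOfLength w (n + 1) := by
    rintro _ ⟨u, hu, rfl⟩
    exact ⟨by simp [hu.1], he u hu.2⟩
  have hcard := Set.ncard_sdiff_add_ncard_of_subset hsub (finite_factorsOfLength w _)
  rw [Set.ncard_image_of_injective _ hinj] at hcard
  have hdiff : factorsOfLength w (n + 1) \ (fun u => u ++ [e u]) '' factorsOfLength w n =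
      extraFactors w e n := by
    ext v
    refine and_congr_right fun hv => ⟨?_, ?_⟩
    · rintro h u rfl
      obtain ⟨hlen, i, hi⟩ := hv
      exact h ⟨u, ⟨by simpa using hlen, i, (mem_occurrences_concat.1 hi).1⟩, rfl⟩
    · rintro h ⟨u, -, rfl⟩
      exact h u rfl
  rw [hdiff] at hcard
  omega

theorem ncard_factorsOfLength_of_two_returns [Finite α] (hrec : Recurrent w)
    (h2 : ∀ u, IsFactor w u → (ReturnWords w u).encard = 2) (n : ℕ) :
    (factorsOfLength w n).ncard = n + 1 := by
  obtain ⟨e, he, hcard⟩ := exists_ncard_factorsOfLength_succ w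
  obtain ⟨a, b, hab, hrange⟩ := exists_range_eq_pair (h2 [] ⟨0, rfl⟩)
  have hl : ∀ i, w i = a ∨ w i = b := fun i => by
    have : w i ∈ Set.range w := ⟨i, rfl⟩
    simpa [hrange] using this
  induction n with
  | zero => simp [factorsOfLength_zero]
  | succ n ih =>
    rw [hcard, ih, Nat.add_left_cancel_iff, Set.ncard_eq_one]
    obtain ⟨x, hxn, hx⟩ := exists_rightSpecial h2 n
    obtain ⟨c, hc⟩ := hx.exists_mem_extraFactors hxn e
    refine ⟨x ++ [c], Set.eq_singleton_iff_unique_mem.2 ⟨hc, fun v hv => ?_⟩⟩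
    obtain rfl | ⟨v, d, rfl⟩ := v.eq_nil_or_concat'
    · simp [extraFactors, factorsOfLength] at hv
    rw [concat_mem_extraFactors] at hc hv
    obtain ⟨⟨hvn, hvf⟩, hd⟩ := hv
    have hv' : IsFactor w v := by
      obtain ⟨i, hi⟩ := hvf
      exact ⟨i, (mem_occurrences_concat.1 hi).1⟩
    have hvs : RightSpecial w v := ⟨d, e v, hd, hvf, he v hv'⟩
    obtain rfl := hvs.unique hrec h2 hx (by simp at hvn; omega)
    obtain ⟨i, hi⟩ := hvf
    obtain ⟨j, hj⟩ := hc.1.2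
    obtain ⟨k, hk⟩ := he v hv'
    have h1 := (mem_occurrences_concat.1 hi).2
    have h3 := (mem_occurrences_concat.1 hj).2
    have h4 := (mem_occurrences_concat.1 hk).2
    have h5 := hl (i + v.length)
    have h6 := hl (j + v.length)
    have h7 := hl (k + v.length)
    grind

end Complexity

section Sturmian

variable {w : ℕ → α}

theorem Sturmian.rightSpecial_unique [Finite α] (h : Sturmian w) {u v : List α}
    (hu : RightSpecial w u) (hv : RightSpecial w v) (hlen : u.length = v.length) : u = v := by
  obtain ⟨e, -, hcard⟩ := exists_ncard_factorsOfLength_succ w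
  have hone := hcard u.length
  rw [factorsOfLength, factorsOfLength, h.2, h.2, Nat.add_left_cancel_iff, eq_comm,
    Set.ncard_eq_one] at hone
  obtain ⟨y, hy⟩ := hone
  obtain ⟨a, ha⟩ := hu.exists_mem_extraFactors rfl e
  obtain ⟨b, hb⟩ := hv.exists_mem_extraFactors hlen.symm e
  rw [hy, Set.mem_singleton_iff] at ha hb
  exact (List.append_inj' (ha.trans hb.symm) rfl).1

theorem Sturmian.ncard_range (h : Sturmian w) : (Set.range w).ncard = 2 := by
  rw [← one_add_one_eq_two, ← h.2 1, ← Set.ncard_image_of_injective (f := fun a => [a]) _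
    (fun a b hab => by simpa using hab)]
  congr 1
  ext u
  constructor
  · rintro ⟨_, ⟨i, rfl⟩, rfl⟩
    exact ⟨rfl, i, by simp [factorAt]⟩
  · rintro ⟨hu, i, hi⟩
    rw [hu] at hi
    exact ⟨w i, ⟨i, rfl⟩, by simpa [factorAt] using hi⟩

/-- An aperiodic recurrent word is not determined by what follows a factor. -/
theorem exists_ne_of_aperiodic (hrec : Recurrent w) (hap : Aperiodic w) {u : List α}
    (hu : IsFactor w u) :
    ∃ m, ∃ i ∈ Occurrences w u, ∃ j ∈ Occurrences w u, w (i + m) ≠ w (j + m) := by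
  by_contra! hdet
  obtain ⟨i, hi⟩ := hu
  obtain ⟨j, hj⟩ := hrec.exists_consecutiveOcc hi
  have hij := hj.2.2.1
  refine hap ⟨j - i, by omega, fun n => ?_⟩
  obtain ⟨k, hik, hk⟩ := hrec _ (isFactor_factorAt w n (j - i + 1)) i
  have hk' := mem_occurrences_factorAt.1 hk
  have h0 := hk' 0 (by omega)
  have h1 := hk' (j - i) (by omega)
  have h2 := hdet (k - i) i hi j hj.2.1
  rw [show i + (k - i) = k by omega, show j + (k - i) = k + (j - i) by omega] at h2
  rw [← h1, ← h2]
  exact h0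

/-- Every factor of an aperiodic recurrent word has the same occurrences as some right
special factor. -/
theorem exists_rightSpecial_occurrences_eq (hrec : Recurrent w) (hap : Aperiodic w)
    {u : List α} (hu : IsFactor w u) :
    ∃ v, RightSpecial w v ∧ Occurrences w u = Occurrences w v := by
  classical
  have hex := exists_ne_of_aperiodic hrec hap hu
  obtain ⟨i, hi, j, hj, hij⟩ := Nat.find_spec hex
  have hmin : ∀ m < Nat.find hex, ∀ i ∈ Occurrences w u, ∀ j ∈ Occurrences w u,
      w (i + m) = w (j + m) := by
    intro m hm
    simpa using Nat.find_min hex hm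
  have hlen : u.length ≤ Nat.find hex := by
    by_contra hlt
    exact hij (eq_of_mem_occurrences hi hj _ (by omega))
  generalize Nat.find hex = n at hij hmin hlen
  have hocc : Occurrences w u = Occurrences w (factorAt w i n) := by
    ext k
    rw [mem_occurrences_factorAt]
    refine ⟨fun hk m hm => hmin m hm k hk i hi, fun hk => ?_⟩
    exact mem_occurrences_of_eq hi fun m hm => (hk m (by omega)).symm
  refine ⟨factorAt w i n, rightSpecial_iff.2 ⟨i, j, ?_, ?_, by simpa⟩, hocc⟩
  · rwa [← hocc]
  · rwa [← hocc]

/-- If a factor is the only right special factor of its length, its return words are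
determined by the letter following it. -/
theorem factorAt_eq_of_rightSpecial_unique {u : List α}
    (huniq : ∀ v, RightSpecial w v → v.length = u.length → v = u) {i j i' j' : ℕ}
    (h : ConsecutiveOcc w u i j) (h' : ConsecutiveOcc w u i' j')
    (hl : w (i + u.length) = w (i' + u.length)) :
    factorAt w i (j - i) = factorAt w i' (j' - i') := by
  have hagree : ∀ m < u.length + min (j - i) (j' - i'), w (i + m) = w (i' + m) := by
    intro m
    induction m using Nat.strong_induction_on with
    | _ m ih =>
      intro hm
      rcases lt_trichotomy m u.length with hlt | rfl | hgt
      · exact eq_of_mem_occurrences h.1 h'.1 m hlt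
      · exact hl
      · by_contra hne
        obtain ⟨s, rfl⟩ : ∃ s, m = s + u.length := ⟨m - u.length, by omega⟩
        refine h.2.2.2 (i + s) (by omega) (by omega) ?_
        have hs : RightSpecial w (factorAt w (i + s) u.length) := by
          refine rightSpecial_iff.2 ⟨i + s, i' + s, ?_, ?_, ?_⟩
          · simp [mem_occurrences_factorAt]
          · refine mem_occurrences_factorAt.2 fun k hk => ?_
            simpa [Nat.add_assoc] using (ih (s + k) (by omega) (by omega)).symm
          · simpa [Nat.add_assoc] using hne
        exact huniq _ hs (by simp)
  have hlen := h.sub_eq h' hagree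
  rw [← hlen, factorAt_eq_iff]
  exact fun k hk => hagree k (by omega)

theorem Sturmian.encard_returnWords [Finite α] (h : Sturmian w) (hrec : Recurrent w)
    {u : List α} (hu : IsFactor w u) : (ReturnWords w u).encard = 2 := by
  obtain ⟨v, hv, hocc⟩ := exists_rightSpecial_occurrences_eq hrec h.1 hu
  rw [returnWords_eq_of_occurrences_eq hocc]
  obtain ⟨a, b, hab, hrange⟩ := Set.ncard_eq_two.1 h.ncard_range
  have hl : ∀ i, w i = a ∨ w i = b := fun i => by
    have : w i ∈ Set.range w := ⟨i, rfl⟩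
    simpa [hrange] using this
  obtain ⟨i, j, hi, hj, hij⟩ := rightSpecial_iff.1 hv
  obtain ⟨i', hi'⟩ := hrec.exists_consecutiveOcc hi
  obtain ⟨j', hj'⟩ := hrec.exists_consecutiveOcc hj
  have hdet := @factorAt_eq_of_rightSpecial_unique _ w v
    fun x hx hlen => h.rightSpecial_unique hx hv hlen
  refine Set.encard_eq_two.2
    ⟨factorAt w i (i' - i), factorAt w j (j' - j), fun heq => hij ?_, ?_⟩
  · exact (hi'.eq_of_factorAt_eq hj' heq).2 _ (by have := hi'.2.2.1; omega)
  · ext r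
    rw [mem_returnWords]
    constructor
    · rintro ⟨k, k', hk, rfl⟩
      have : w (k + v.length) = w (i + v.length) ∨ w (k + v.length) = w (j + v.length) := by
        have h1 := hl (k + v.length)
        have h2 := hl (i + v.length)
        have h3 := hl (j + v.length)
        grind
      exact this.imp (hdet hk hi') (hdet hk hj')
    · rintro (rfl | rfl)
      · exact ⟨i, i', hi', rfl⟩
      · exact ⟨j, j', hj', rfl⟩

end Sturmian

/-- Vuillon. A recurrent infinite word has two return words for each of
its factors if and only if it is Sturmian. -/
theorem recurrent_two_returns_iff_sturmian {α : Type*} [Fintype α]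
    (w : ℕ → α) (hrec : Recurrent w) :
    (∀ u : List α, IsFactor w u → (ReturnWords w u).encard = 2) ↔ Sturmian w :=
  ⟨fun h => ⟨aperiodic_of_two_returns h, ncard_factorsOfLength_of_two_returns hrec h⟩,
    fun h _ hu => h.encard_returnWords hrec hu⟩
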